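/- Fix integers k ≥ 1 and d ≥ 0 and fix infinite words w, w' over [k]. With A[0], A[1], ..., A[L−1] the sets defined from w, w' as below, each written as a word over the alphabet {0,1,...,d} by listing its elements in decreasing order, the concatenated word A[0]A[1]⋯A[L−1] satisfies LNDS_i( A[0]A[1]⋯A[L−1] ) = P_i(L) − i for every i with 0 ≤ i ≤ d. -/

import Mathlib

/-- `u` is `d`-almost contained in `v`: one may remove at most `d` symbols from `u`
and obtain a subsequence of `v`. -/
def AlmostIn (d : ℕ) (u v : List ℕ) : Prop :=
  ∃ s : List ℕ, s.Sublist u ∧ u.length ≤ s.length + d ∧ s.Sublist v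

/-- The length-`m` prefix of an infinite word `w : ℕ → ℕ`. -/
def pre (w : ℕ → ℕ) (m : ℕ) : List ℕ :=
  (List.range m).map w

/-- `Pd i L w w'` is `P_i(L)`: the length of the longest prefix of the infinite word `w`
that is `i`-almost contained in the length-`L` prefix of `w'`. -/
noncomputable def Pd (i L : ℕ) (w w' : ℕ → ℕ) : ℕ :=
  sSup {m | AlmostIn i (pre w m) (pre w' L)}

/-- Length of a longest non-decreasing subsequence of a word. -/
noncomputable def LNDS {α : Type*} [LinearOrder α] (w : List α) : ℕ :=
  sSup {n | ∃ u : List α, u.Sublist w ∧ u.Chain' (· ≤ ·) ∧ u.length = n}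

/-- The set `A[ℓ] = {j ∈ {0,…,d} : w[P_j(ℓ)] = w'[ℓ]}` written as a word by listing its
elements in decreasing order. -/
noncomputable def Aword (d : ℕ) (w w' : ℕ → ℕ) (ℓ : ℕ) : List ℕ :=
  (((List.range (d + 1)).filter fun j => decide (w (Pd j ℓ w w') = w' ℓ)).reverse)

theorem AlmostIn.append_right {d : ℕ} {u v : List ℕ} (h : AlmostIn d u v) (t : List ℕ) :
    AlmostIn d u (v ++ t) := by
  obtain ⟨s, h1, h2, h3⟩ := h
  exact ⟨s, h1, h2, h3.trans (List.sublist_append_left _ _)⟩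

theorem AlmostIn.append_both {d : ℕ} {u v : List ℕ} (h : AlmostIn d u v) (a : ℕ) :
    AlmostIn d (u ++ [a]) (v ++ [a]) := by
  obtain ⟨s, h1, h2, h3⟩ := h
  exact ⟨s ++ [a], h1.append_right _, by simp; omega, h3.append_right _⟩

theorem AlmostIn.append_left {d : ℕ} {u v : List ℕ} (h : AlmostIn d u v) (a : ℕ) :
    AlmostIn (d + 1) (u ++ [a]) v := by
  obtain ⟨s, h1, h2, h3⟩ := h
  exact ⟨s, h1.trans (List.sublist_append_left _ _), by simp; omega, h3⟩

theorem AlmostIn.length_le {d : ℕ} {u v : List ℕ} (h : AlmostIn d u v) :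
    u.length ≤ v.length + d := by
  obtain ⟨s, -, h2, h3⟩ := h
  have := h3.length_le
  omega

theorem sublist_singleton_cases {α : Type*} {s : List α} {a : α} (h : s.Sublist [a]) :
    s = [] ∨ s = [a] := by
  rcases s with _ | ⟨b, s⟩
  · exact Or.inl rfl
  · exact Or.inr (h.eq_of_length_le (by simp))

theorem AlmostIn.append_cases {d : ℕ} {u v : List ℕ} {a b : ℕ}
    (h : AlmostIn d (u ++ [a]) (v ++ [b])) :
    (AlmostIn d u v ∧ a = b) ∨ (∃ e, d = e + 1 ∧ AlmostIn e u (v ++ [b])) ∨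
      AlmostIn d (u ++ [a]) v := by
  obtain ⟨s, h1, h2, h3⟩ := h
  obtain ⟨s₁, s₂, rfl, hu, ha⟩ := List.sublist_append_iff.1 h1
  have hl := hu.length_le
  rcases sublist_singleton_cases ha with rfl | rfl
  · simp only [List.append_nil, List.length_append, List.length_singleton] at h1 h2 h3
    exact Or.inr (Or.inl ⟨d - 1, by omega, s₁, hu, by omega, h3⟩)
  · obtain ⟨t₁, t₂, ht, hv, hb⟩ := List.sublist_append_iff.1 h3
    rcases sublist_singleton_cases hb with rfl | rfl
    · rw [List.append_nil] at ht
      exact Or.inr (Or.inr ⟨_, h1, h2, ht ▸ hv⟩)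
    · obtain ⟨rfl, hab⟩ := List.append_inj' ht rfl
      simp only [List.length_append, List.length_singleton] at h2
      exact Or.inl ⟨⟨s₁, hu, by omega, hv⟩, by simpa using hab⟩

theorem pre_succ (w : ℕ → ℕ) (m : ℕ) : pre w (m + 1) = pre w m ++ [w m] := by
  simp [pre, List.range_succ]

theorem length_pre (w : ℕ → ℕ) (m : ℕ) : (pre w m).length = m := by
  simp [pre]

section Prefix

variable {w w' : ℕ → ℕ} {i L m : ℕ}

theorem bddAbove_almostIn_pre (i L : ℕ) (w w' : ℕ → ℕ) :
    BddAbove {m | AlmostIn i (pre w m) (pre w' L)} :=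
  ⟨L + i, fun m hm => by simpa [length_pre] using hm.length_le⟩

theorem le_Pd (h : AlmostIn i (pre w m) (pre w' L)) : m ≤ Pd i L w w' :=
  le_csSup (bddAbove_almostIn_pre i L w w') h

theorem almostIn_Pd (i L : ℕ) (w w' : ℕ → ℕ) :
    AlmostIn i (pre w (Pd i L w w')) (pre w' L) :=
  Nat.sSup_mem (s := {m | AlmostIn i (pre w m) (pre w' L)})
    ⟨0, [], by simp, by simp [pre], by simp⟩ (bddAbove_almostIn_pre i L w w')

theorem Pd_le_Pd_succ : Pd i L w w' ≤ Pd i (L + 1) w w' := by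
  apply le_Pd
  rw [pre_succ w']
  exact (almostIn_Pd i L w w').append_right _

theorem Pd_succ_le_of_eq (h : w (Pd i L w w') = w' L) :
    Pd i L w w' + 1 ≤ Pd i (L + 1) w w' := by
  apply le_Pd
  rw [pre_succ w', pre_succ, h]
  exact (almostIn_Pd i L w w').append_both _

theorem Pd_add_one_le : Pd i L w w' + 1 ≤ Pd (i + 1) L w w' := by
  apply le_Pd
  rw [pre_succ]
  exact (almostIn_Pd i L w w').append_left _

theorem Pd_add_le (n : ℕ) : Pd i L w w' + n ≤ Pd (i + n) L w w' := by
  induction n with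
  | zero => simp
  | succ n ih =>
    have := Pd_add_one_le (w := w) (w' := w') (i := i + n) (L := L)
    rw [← Nat.add_assoc, ← Nat.add_assoc]
    omega

theorem le_Pd_self (i L : ℕ) (w w' : ℕ → ℕ) : i ≤ Pd i L w w' :=
  le_Pd ⟨[], by simp, by simp [length_pre], by simp⟩

theorem Pd_zero (i : ℕ) (w w' : ℕ → ℕ) : Pd i 0 w w' = i := by
  refine le_antisymm ?_ (le_Pd_self i 0 w w')
  simpa [length_pre] using (almostIn_Pd i 0 w w').length_le

theorem Pd_succ_cases (i L : ℕ) (w w' : ℕ → ℕ) :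
    Pd i (L + 1) w w' = Pd i L w w' ∨
      (w (Pd i L w w') = w' L ∧ Pd i (L + 1) w w' = Pd i L w w' + 1) ∨
      ∃ j, i = j + 1 ∧ Pd i (L + 1) w w' = Pd j (L + 1) w w' + 1 := by
  have hle := Pd_le_Pd_succ (w := w) (w' := w') (i := i) (L := L)
  have h := almostIn_Pd i (L + 1) w w'
  rcases hm : Pd i (L + 1) w w' with _ | m
  · left
    omega
  rw [hm, pre_succ, pre_succ] at h
  rcases h.append_cases with ⟨h, hab⟩ | ⟨j, rfl, hj⟩ | h
  · have := le_Pd h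
    rcases Nat.lt_or_ge m (Pd i L w w') with hlt | hge
    · left
      omega
    · have hmeq : Pd i L w w' = m := by omega
      exact Or.inr (Or.inl ⟨by rw [hmeq, hab], by omega⟩)
  · rw [← pre_succ w'] at hj
    have h1 := le_Pd hj
    have h2 := Pd_add_one_le (w := w) (w' := w') (i := j) (L := L + 1)
    exact Or.inr (Or.inr ⟨j, rfl, by omega⟩)
  · rw [← pre_succ] at h
    have := le_Pd h
    left
    omega

end Prefix

/-- The concatenation `A[0]A[1]⋯A[L-1]`. -/
noncomputable def Aconcat (d : ℕ) (w w' : ℕ → ℕ) (L : ℕ) : List ℕ :=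
  ((List.range L).map fun ℓ => Aword d w w' ℓ).flatten

theorem Aconcat_succ (d : ℕ) (w w' : ℕ → ℕ) (L : ℕ) :
    Aconcat d w w' (L + 1) = Aconcat d w w' L ++ Aword d w w' L := by
  simp [Aconcat, List.range_succ]

theorem mem_Aword {d : ℕ} {w w' : ℕ → ℕ} {L j : ℕ} :
    j ∈ Aword d w w' L ↔ j ≤ d ∧ w (Pd j L w w') = w' L := by
  simp [Aword]

theorem pairwise_Aword (d : ℕ) (w w' : ℕ → ℕ) (L : ℕ) :
    (Aword d w w' L).Pairwise (· > ·) := by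
  rw [Aword, List.pairwise_reverse]
  exact List.Pairwise.filter _ List.pairwise_lt_range

theorem eq_nil_or_singleton_of_pairwise {α : Type*} [LinearOrder α] {u : List α}
    (h₁ : u.Pairwise (· ≤ ·)) (h₂ : u.Pairwise (· > ·)) : u = [] ∨ ∃ a, u = [a] := by
  rcases u with _ | ⟨a, _ | ⟨b, u⟩⟩
  · exact Or.inl rfl
  · exact Or.inr ⟨a, rfl⟩
  · have h := List.rel_of_pairwise_cons h₁ (List.mem_cons_self (a := b))
    have h' := List.rel_of_pairwise_cons h₂ (List.mem_cons_self (a := b))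
    exact absurd h' (not_lt.2 h)

theorem length_add_le_Pd {d : ℕ} {w w' : ℕ → ℕ} {L i : ℕ} {u : List ℕ}
    (hu : u.Sublist (Aconcat d w w' L)) (hi : ∀ x ∈ u, x ≤ i) (hp : u.Pairwise (· ≤ ·)) :
    u.length + i ≤ Pd i L w w' := by
  induction L generalizing i u with
  | zero =>
    have : u = [] := by simpa [Aconcat] using hu
    simp [this, Pd_zero]
  | succ L ih =>
    rw [Aconcat_succ] at hu
    obtain ⟨u₁, u₂, rfl, h₁, h₂⟩ := List.sublist_append_iff.1 hu
    obtain ⟨hp₁, hp₂, hcross⟩ := List.pairwise_append.1 hp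
    rcases eq_nil_or_singleton_of_pairwise hp₂ ((pairwise_Aword d w w' L).sublist h₂) with
      rfl | ⟨j, rfl⟩
    · rw [List.append_nil] at hi ⊢
      exact (ih h₁ hi hp₁).trans Pd_le_Pd_succ
    · have hj := (mem_Aword.1 (h₂.subset (List.mem_singleton_self j))).2
      have hji : j ≤ i := hi j (by simp)
      have h3 := ih h₁ (fun x hx => hcross x hx j (by simp)) hp₁
      have h4 := Pd_succ_le_of_eq hj
      have h5 := Pd_add_le (w := w) (w' := w') (i := j) (L := L + 1) (i - j)
      rw [Nat.add_sub_cancel' hji] at h5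
      simp only [List.length_append, List.length_singleton]
      omega

theorem exists_length_add_eq_Pd {d i : ℕ} (w w' : ℕ → ℕ) (L : ℕ) (hid : i ≤ d) :
    ∃ u : List ℕ, u.Sublist (Aconcat d w w' L) ∧ (∀ x ∈ u, x ≤ i) ∧ u.Pairwise (· ≤ ·) ∧
      u.length + i = Pd i L w w' := by
  induction L generalizing i with
  | zero => exact ⟨[], by simp, by simp, by simp, by simp [Pd_zero]⟩
  | succ L ihL =>
    induction i using Nat.strong_induction_on with
    | _ i ihi =>
      rw [Aconcat_succ] at ihi ⊢
      rcases Pd_succ_cases i L w w' with h | ⟨hA, h⟩ | ⟨j, rfl, h⟩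
      · obtain ⟨u, hu, hle, hp, hlen⟩ := ihL hid
        exact ⟨u, hu.trans (List.sublist_append_left _ _), hle, hp, by omega⟩
      · obtain ⟨u, hu, hle, hp, hlen⟩ := ihL hid
        refine ⟨u ++ [i], hu.append (List.singleton_sublist.2 (mem_Aword.2 ⟨hid, hA⟩)), ?_, ?_, ?_⟩
        · intro x hx
          rcases List.mem_append.1 hx with hx | hx
          · exact hle x hx
          · exact (List.mem_singleton.1 hx).le
        · exact List.pairwise_append.2 ⟨hp, by simp, by simpa using hle⟩
        · rw [List.length_append, List.length_singleton]
          omega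
      · obtain ⟨u, hu, hle, hp, hlen⟩ := ihi j (by omega) (by omega)
        exact ⟨u, hu, fun x hx => (hle x hx).trans (by omega), hp, by omega⟩

/-- Fix `k ≥ 1`, `d ≥ 0` and infinite words `w, w'` over `[k] = {1,…,k}`.
Then the concatenated word `A[0]A[1]⋯A[L-1]` satisfies
`LNDS_i(A[0]A[1]⋯A[L-1]) = P_i(L) − i` for every `0 ≤ i ≤ d`, where `LNDS_i(u)` is the
length of a longest non-decreasing subsequence of the word obtained from `u` by deleting
all symbols greater than `i`. -/
theorem stmt6 (k d : ℕ) (hk : 1 ≤ k) (w w' : ℕ → ℕ)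
    (hw : ∀ j, 1 ≤ w j ∧ w j ≤ k) (hw' : ∀ j, 1 ≤ w' j ∧ w' j ≤ k)
    (L : ℕ) (i : ℕ) (hi : i ≤ d) :
    LNDS ((((List.range L).map fun ℓ => Aword d w w' ℓ).flatten).filter fun s => decide (s ≤ i)) =
      Pd i L w w' - i := by
  have hset : IsGreatest {n | ∃ u : List ℕ,
      u.Sublist ((Aconcat d w w' L).filter fun s => decide (s ≤ i)) ∧
        u.IsChain (· ≤ ·) ∧ u.length = n} (Pd i L w w' - i) := by
    constructor
    · obtain ⟨u, hu, hle, hp, hlen⟩ := exists_length_add_eq_Pd w w' L hi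
      refine ⟨u, ?_, List.isChain_iff_pairwise.2 hp, by omega⟩
      have := hu.filter fun s => decide (s ≤ i)
      rwa [List.filter_eq_self.2 (by simpa using hle)] at this
    · rintro n ⟨u, hu, hc, rfl⟩
      have := length_add_le_Pd (i := i) (hu.trans List.filter_sublist)
        (fun x hx => by simpa using (List.mem_filter.1 (hu.subset hx)).2)
        (List.isChain_iff_pairwise.1 hc)
      omega
  exact hset.csSup_eq
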